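/- arXiv:0907.5338 — 2 statements merged into one kernel-verified Lean document; each statement's English description precedes it below -/
import Mathlib

section
/- Let f be a regular function in F_op with Morozova-Chentsov function c, let ρ be a positive definite bipartite density matrix on ℂ^n ⊗ ℂ^m with partial traces ρ₁ = Tr₂ρ and ρ₂ = Tr₁ρ, let A be an n×n complex Hermitian matrix and B an m×m complex Hermitian matrix. Then I^c_ρ(A ⊗ 1₂ + 1₁ ⊗ B) + I^c_ρ(A ⊗ 1₂ − 1₁ ⊗ B) ≥ 2·(I^c_{ρ₁}(A) + I^c_{ρ₂}(B)). -/
open Matrix Kronecker ComplexOrder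

/-- Functional calculus: apply `g : ℝ → ℝ` to a Hermitian matrix via its spectral
decomposition (junk value `0` on non-Hermitian matrices). -/
noncomputable def matFun {ι : Type} [Fintype ι] [DecidableEq ι] (g : ℝ → ℝ)
    (M : Matrix ι ι ℂ) : Matrix ι ι ℂ :=
  if hM : M.IsHermitian then
    ∑ i, (g (hM.eigenvalues i) : ℂ) •
      Matrix.vecMulVec (⇑(hM.eigenvectorBasis i)) (star ⇑(hM.eigenvectorBasis i))
  else 0

/-- Operator monotonicity on `(0,∞)`: monotone w.r.t. the Loewner order on positive
definite complex Hermitian matrices of all sizes. -/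
def OperatorMonotone (g : ℝ → ℝ) : Prop :=
  ∀ (k : ℕ) (A B : Matrix (Fin k) (Fin k) ℂ), A.PosDef → B.PosDef →
    (B - A).PosSemidef → (matFun g B - matFun g A).PosSemidef

/-- Operator convexity on `(0,∞)` for positive definite complex Hermitian matrices
of all sizes. -/
def OperatorConvex (g : ℝ → ℝ) : Prop :=
  ∀ (k : ℕ) (A B : Matrix (Fin k) (Fin k) ℂ), A.PosDef → B.PosDef →
    ∀ t : ℝ, 0 ≤ t → t ≤ 1 →
      (t • matFun g A + (1 - t) • matFun g B - matFun g (t • A + (1 - t) • B)).PosSemidef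

/-- `ĉ(x,y) = (x-y)² · c(x,y)` where `c(x,y) = 1/(y·f(x/y))` is the
Morozova-Chentsov function associated with `f`. -/
noncomputable def chat (f : ℝ → ℝ) (x y : ℝ) : ℝ :=
  (x - y) ^ 2 * (1 / (y * f (x / y)))

/-- The quadratic form `Σ_{k,l} ĉ(λ_k,λ_l)·|⟨u_k, A u_l⟩|²` computed from the spectral
decomposition of the Hermitian matrix `ρ` (junk value `0` on non-Hermitian matrices). -/
noncomputable def skewSum {ι : Type} [Fintype ι] [DecidableEq ι] (f : ℝ → ℝ)
    (ρ A : Matrix ι ι ℂ) : ℝ :=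
  if hρ : ρ.IsHermitian then
    ∑ i, ∑ j, chat f (hρ.eigenvalues i) (hρ.eigenvalues j) *
      Complex.normSq (star ⇑(hρ.eigenvectorBasis i) ⬝ᵥ A *ᵥ ⇑(hρ.eigenvectorBasis j))
  else 0

/-- The metric adjusted skew information
`I^c_ρ(A) = (f(0)/2)·Σ_{k,l} ĉ(λ_k,λ_l)·|⟨u_k, A u_l⟩|²`. -/
noncomputable def Ic {ι : Type} [Fintype ι] [DecidableEq ι] (f : ℝ → ℝ)
    (ρ A : Matrix ι ι ℂ) : ℝ :=
  (f 0 / 2) * skewSum f ρ A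

/-- Partial trace over the second factor. -/
noncomputable def ptrace2 {n m : ℕ} (ρ : Matrix (Fin n × Fin m) (Fin n × Fin m) ℂ) :
    Matrix (Fin n) (Fin n) ℂ :=
  Matrix.of fun i i' => ∑ j, ρ (i, j) (i', j)

/-- Partial trace over the first factor. -/
noncomputable def ptrace1 {n m : ℕ} (ρ : Matrix (Fin n × Fin m) (Fin n × Fin m) ℂ) :
    Matrix (Fin m) (Fin m) ℂ :=
  Matrix.of fun j j' => ∑ i, ρ (i, j) (i, j')

section Spectral

variable {ι β : Type} [Fintype ι] [DecidableEq ι] [Fintype β] [DecidableEq β]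

theorem Matrix.IsHermitian.mul_eigenvectorUnitary {M : Matrix ι ι ℂ} (hM : M.IsHermitian) :
    M * (hM.eigenvectorUnitary : Matrix ι ι ℂ) =
      hM.eigenvectorUnitary * diagonal fun i => (hM.eigenvalues i : ℂ) := by
  have h := hM.spectral_theorem
  rw [Unitary.conjStarAlgAut_apply] at h
  calc M * (hM.eigenvectorUnitary : Matrix ι ι ℂ) = _ := congrArg (· * _) h
    _ = _ := by
      rw [Matrix.mul_assoc, Unitary.coe_star_mul_self, Matrix.mul_one]
      rfl

theorem Matrix.IsHermitian.eigenvectorUnitary_conjTranspose_mul {M : Matrix ι ι ℂ}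
    (hM : M.IsHermitian) :
    (hM.eigenvectorUnitary : Matrix ι ι ℂ)ᴴ * hM.eigenvectorUnitary = 1 :=
  Unitary.coe_star_mul_self _

theorem Matrix.IsHermitian.eigenvectorUnitary_mul_conjTranspose {M : Matrix ι ι ℂ}
    (hM : M.IsHermitian) :
    (hM.eigenvectorUnitary : Matrix ι ι ℂ) * (hM.eigenvectorUnitary : Matrix ι ι ℂ)ᴴ = 1 :=
  Unitary.coe_mul_star_self _

theorem matFun_eq (g : ℝ → ℝ) {M : Matrix ι ι ℂ} (hM : M.IsHermitian) :
    matFun g M = (hM.eigenvectorUnitary : Matrix ι ι ℂ) *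
      diagonal (fun i => (g (hM.eigenvalues i) : ℂ)) * (hM.eigenvectorUnitary : Matrix ι ι ℂ)ᴴ := by
  ext a b
  rw [Matrix.mul_apply]
  simp only [matFun, dif_pos hM, Matrix.sum_apply, Matrix.smul_apply, vecMulVec_apply,
    mul_diagonal, conjTranspose_apply, smul_eq_mul, Pi.star_apply,
    IsHermitian.eigenvectorUnitary_apply]
  exact Finset.sum_congr rfl fun i _ => by ring

theorem matFun_mul_eq_mul_diagonal (g : ℝ → ℝ) {M : Matrix ι ι ℂ} (hM : M.IsHermitian)
    (W : Matrix ι β ℂ) (e : β → ℝ) (h : M * W = W * diagonal fun b => (e b : ℂ)) :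
    matFun g M * W = W * diagonal fun b => (g (e b) : ℂ) := by
  set U : Matrix ι ι ℂ := (hM.eigenvectorUnitary : Matrix ι ι ℂ) with hU
  have hU1 : Uᴴ * U = 1 := hM.eigenvectorUnitary_conjTranspose_mul
  have hU2 : U * Uᴴ = 1 := hM.eigenvectorUnitary_mul_conjTranspose
  have hMU : Uᴴ * M = diagonal (fun i => (hM.eigenvalues i : ℂ)) * Uᴴ := by
    calc Uᴴ * M = Uᴴ * (M * U) * Uᴴ := by simp only [Matrix.mul_assoc, hU2, Matrix.mul_one]
      _ = _ := by
        rw [hM.mul_eigenvectorUnitary, ← Matrix.mul_assoc, ← hU, hU1, Matrix.one_mul]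
  have hZ : diagonal (fun i => (hM.eigenvalues i : ℂ)) * (Uᴴ * W) =
      (Uᴴ * W) * diagonal fun b => (e b : ℂ) := by
    rw [← Matrix.mul_assoc, ← hMU, Matrix.mul_assoc, h, Matrix.mul_assoc]
  have hgZ : diagonal (fun i => (g (hM.eigenvalues i) : ℂ)) * (Uᴴ * W) =
      (Uᴴ * W) * diagonal fun b => (g (e b) : ℂ) := by
    ext i b
    have := congrFun (congrFun hZ i) b
    rw [diagonal_mul, mul_diagonal] at this ⊢
    rcases eq_or_ne ((Uᴴ * W) i b) 0 with h0 | h0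
    · simp [h0]
    · have : hM.eigenvalues i = e b := by
        have := mul_right_cancel₀ h0 (this.trans (mul_comm _ _))
        exact_mod_cast this
      rw [this, mul_comm]
  rw [matFun_eq g hM, ← hU, Matrix.mul_assoc, Matrix.mul_assoc, hgZ, ← Matrix.mul_assoc,
    ← Matrix.mul_assoc, hU2, Matrix.one_mul]

theorem isHermitian_diagonal_ofReal {ι : Type} [DecidableEq ι] (d : ι → ℝ) :
    (diagonal fun i => (d i : ℂ)).IsHermitian := by
  rw [IsHermitian, diagonal_conjTranspose]
  congr 1
  ext i
  simp

theorem matFun_diagonal (g : ℝ → ℝ) (d : ι → ℝ) :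
    matFun g (diagonal fun i => (d i : ℂ)) = diagonal fun i => (g (d i) : ℂ) := by
  simpa using matFun_mul_eq_mul_diagonal g (isHermitian_diagonal_ofReal d) 1 d (by simp)

theorem star_dotProduct_diagonal_mulVec (d : ι → ℝ) (y : ι → ℂ) :
    star y ⬝ᵥ (diagonal fun i => (d i : ℂ)) *ᵥ y =
      ((∑ i, d i * Complex.normSq (y i) : ℝ) : ℂ) := by
  simp only [dotProduct, mulVec_diagonal, Pi.star_apply, RCLike.star_def]
  push_cast
  refine Finset.sum_congr rfl fun i _ => ?_
  rw [Complex.normSq_eq_conj_mul_self]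
  ring

end Spectral

section OperatorMonotone

variable {f : ℝ → ℝ}

theorem OperatorMonotone.le (hf : OperatorMonotone f) {s t : ℝ} (hs : 0 < s) (hst : s ≤ t) :
    f s ≤ f t := by
  have h := hf 1 (diagonal fun _ => (s : ℂ)) (diagonal fun _ => (t : ℂ))
    (PosDef.diagonal fun _ => by exact_mod_cast hs)
    (PosDef.diagonal fun _ => by exact_mod_cast hs.trans_le hst)
    (by
      rw [diagonal_sub]
      exact PosSemidef.diagonal fun _ => by
        simp only [Pi.zero_apply, sub_nonneg]
        exact_mod_cast hst)
  rw [matFun_diagonal f fun _ => s, matFun_diagonal f fun _ => t, diagonal_sub,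
    posSemidef_diagonal_iff] at h
  have := h 0
  simp only [sub_nonneg] at this
  exact_mod_cast this

theorem OperatorMonotone.le_mul (hf : OperatorMonotone f)
    (hsymm : ∀ t > 0, f t = t * f (1 / t)) {c t : ℝ} (hc : 1 ≤ c) (ht : 0 < t) :
    f (c * t) ≤ c * f t := by
  have hct : 0 < c * t := by positivity
  rw [hsymm _ hct, hsymm t ht, ← mul_assoc]
  exact mul_le_mul_of_nonneg_left
    (hf.le (by positivity) (one_div_le_one_div_of_le ht (le_mul_of_one_le_left ht.le hc))) hct.le

/-- The pinching bound: `D ≤ D'` for a positive definite `D'` which the isometry `W` intertwines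
with `(1 + c²) • (Wᴴ * D * W)`. -/
theorem Matrix.PosDef.exists_pinching {ι β : Type} [Fintype ι] [DecidableEq ι] [Fintype β]
    [DecidableEq β] {D : Matrix ι ι ℂ} (hD : D.PosDef) {W : Matrix ι β ℂ} (hW : Wᴴ * W = 1)
    {c : ℝ} (hc : 0 < c) :
    ∃ D' : Matrix ι ι ℂ, D'.PosDef ∧ (D' - D).PosSemidef ∧
      D' * W = ((1 + c ^ 2 : ℝ) : ℂ) • (W * (Wᴴ * D * W)) := by
  have hc0 : (c : ℂ) ≠ 0 := by exact_mod_cast hc.ne'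
  set P := W * Wᴴ with hP
  have hPH : Pᴴ = P := by simp [hP]
  have hPW : P * W = W := by rw [hP, Matrix.mul_assoc, hW, Matrix.mul_one]
  set S : Matrix ι ι ℂ := (c : ℂ) • P - (c : ℂ)⁻¹ • (1 - P) with hS
  have hSH : Sᴴ = S := by simp [hS, hPH]
  have hSW : S * W = (c : ℂ) • W := by
    simp [hS, Matrix.sub_mul, hPW]
  have hSDS : (S * D * S).PosSemidef := by
    simpa only [hSH] using hD.posSemidef.mul_mul_conjTranspose_same S
  refine ⟨D + S * D * S, hD.add_posSemidef hSDS, by simpa using hSDS, ?_⟩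
  have h1 : W * (Wᴴ * D * W) = P * (D * W) := by simp only [hP, Matrix.mul_assoc]
  rw [h1, Matrix.add_mul, Matrix.mul_assoc _ S, hSW, Matrix.mul_smul, Matrix.mul_assoc S, hS,
    Matrix.sub_mul, Matrix.smul_mul, Matrix.smul_mul, Matrix.sub_mul, Matrix.one_mul, smul_sub,
    smul_smul, smul_smul, mul_inv_cancel₀ hc0, one_smul]
  push_cast
  rw [add_smul, one_smul, pow_two]
  abel

/-- Hansen's form of Jensen's inequality for compressions by an isometry, with the matrix and its
compression both diagonal. -/
theorem OperatorMonotone.sum_mul_normSq_mulVec_le (hf : OperatorMonotone f)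
    (hsymm : ∀ t > 0, f t = t * f (1 / t)) {κ β : Type} [Fintype κ] [DecidableEq κ] [Fintype β]
    [DecidableEq β] {d : κ → ℝ} (hd : ∀ a, 0 < d a) {e : β → ℝ} (he : ∀ b, 0 < e b)
    {W : Matrix κ β ℂ} (hW : Wᴴ * W = 1)
    (hWd : Wᴴ * (diagonal fun a => (d a : ℂ)) * W = diagonal fun b => (e b : ℂ)) (y : β → ℂ) :
    ∑ a, f (d a) * Complex.normSq ((W *ᵥ y) a) ≤ ∑ b, f (e b) * Complex.normSq (y b) := by
  wlog hκ : ∃ k, κ = Fin k generalizing κ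
  · let E := (Fintype.equivFin κ).symm
    have := this (κ := Fin (Fintype.card κ)) (d := d ∘ E) (W := W.submatrix E id)
      (fun a => hd _)
      (by rw [conjTranspose_submatrix, submatrix_mul_equiv, hW]; simp)
      (by
        have h : (diagonal fun a => ((d ∘ E) a : ℂ)) =
          (diagonal fun a => (d a : ℂ)).submatrix E E := by
            rw [submatrix_diagonal_equiv]; rfl
        rw [h, conjTranspose_submatrix, submatrix_mul_equiv, submatrix_mul_equiv, hWd]; simp)
      ⟨_, rfl⟩
    refine le_of_eq_of_le ?_ this
    exact (E.sum_comp fun a => f (d a) * Complex.normSq ((W *ᵥ y) a)).symm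
  obtain ⟨k, rfl⟩ := hκ
  obtain rfl : ‹DecidableEq (Fin k)› = instDecidableEqFin k := Subsingleton.elim _ _
  obtain rfl : ‹Fintype (Fin k)› = Fin.fintype k := Subsingleton.elim _ _
  set L := ∑ a, f (d a) * Complex.normSq ((W *ᵥ y) a)
  set R := ∑ b, f (e b) * Complex.normSq (y b) with hR
  have key : ∀ c : ℝ, 0 < c → L ≤ (1 + c ^ 2) * R := by
    intro c hc
    have hD : (diagonal fun a => (d a : ℂ)).PosDef :=
      PosDef.diagonal fun a => by exact_mod_cast hd a
    obtain ⟨D', hD', hle, hD'W⟩ := hD.exists_pinching hW hc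
    have hD'W' : D' * W = W * diagonal fun b => (((1 + c ^ 2) * e b : ℝ) : ℂ) := by
      rw [hD'W, hWd, ← Matrix.mul_smul, ← diagonal_smul]
      congr 2
      ext b
      simp
    have h1 := ((hf k _ _ hD hD' hle).conjTranspose_mul_mul_same W).dotProduct_mulVec_nonneg y
    rw [Matrix.mul_sub, Matrix.sub_mul, Matrix.mul_assoc Wᴴ (matFun f D'),
      matFun_mul_eq_mul_diagonal f hD'.1 W _ hD'W', ← Matrix.mul_assoc, hW, Matrix.one_mul,
      Matrix.sub_mulVec, dotProduct_sub, star_dotProduct_diagonal_mulVec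
        (fun b => f ((1 + c ^ 2) * e b)), matFun_diagonal, ← mulVec_mulVec, ← mulVec_mulVec,
      dotProduct_mulVec, ← star_mulVec, star_dotProduct_diagonal_mulVec (fun a => f (d a)),
      sub_nonneg] at h1
    have h2 : L ≤ ∑ b, f ((1 + c ^ 2) * e b) * Complex.normSq (y b) := by exact_mod_cast h1
    refine h2.trans ?_
    rw [hR, Finset.mul_sum]
    refine Finset.sum_le_sum fun b _ => ?_
    rw [← mul_assoc]
    exact mul_le_mul_of_nonneg_right (hf.le_mul hsymm (by nlinarith) (he b))
      (Complex.normSq_nonneg _)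
  have hlim : Filter.Tendsto (fun c : ℝ => (1 + c ^ 2) * R) (nhdsWithin 0 (Set.Ioi 0))
      (nhds R) := by
    have : Continuous fun c : ℝ => (1 + c ^ 2) * R := by fun_prop
    simpa using (this.tendsto 0).mono_left nhdsWithin_le_nhds
  exact ge_of_tendsto hlim (eventually_mem_nhdsWithin.mono key)

end OperatorMonotone

section Monotonicity

variable {f : ℝ → ℝ} {κ β : Type} [Fintype κ] [DecidableEq κ] [Fintype β] [DecidableEq β]

/-- The transformer inequality for the operator mean with representing function `f`, applied to
commuting diagonal matrices. -/
theorem OperatorMonotone.transformer (hf : OperatorMonotone f)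
    (hsymm : ∀ t > 0, f t = t * f (1 / t)) {p q : κ → ℝ} (hp : ∀ a, 0 < p a) (hq : ∀ a, 0 < q a)
    {r s : β → ℝ} (hr : ∀ b, 0 < r b) (hs : ∀ b, 0 < s b) {V : Matrix κ β ℂ}
    (hVp : Vᴴ * (diagonal fun a => (p a : ℂ)) * V = diagonal fun b => (r b : ℂ))
    (hVq : Vᴴ * (diagonal fun a => (q a : ℂ)) * V = diagonal fun b => (s b : ℂ)) (y : β → ℂ) :
    ∑ a, q a * f (p a / q a) * Complex.normSq ((V *ᵥ y) a) ≤
      ∑ b, s b * f (r b / s b) * Complex.normSq (y b) := by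
  have hsq : ∀ {x : ℝ}, 0 < x → ((√x : ℝ) : ℂ) * ((√x : ℝ) : ℂ) = (x : ℂ) := fun hx => by
    rw [← Complex.ofReal_mul, Real.mul_self_sqrt hx.le]
  have hsq0 : ∀ {x : ℝ}, 0 < x → ((√x : ℝ) : ℂ) ≠ 0 := fun hx => by
    exact_mod_cast (Real.sqrt_pos.2 hx).ne'
  set Q : Matrix κ κ ℂ := diagonal fun a => ((√(q a) : ℝ) : ℂ) with hQ
  set T : Matrix β β ℂ := diagonal fun b => (((√(s b))⁻¹ : ℝ) : ℂ) with hT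
  have hQH : Qᴴ = Q := isHermitian_diagonal_ofReal _
  have hTH : Tᴴ = T := isHermitian_diagonal_ofReal _
  have hcomp : ∀ D : Matrix κ κ ℂ, (Q * V * T)ᴴ * D * (Q * V * T) =
      T * (Vᴴ * (Q * D * Q) * V) * T := fun D => by
    simp only [conjTranspose_mul, hQH, hTH, Matrix.mul_assoc]
  have h := hf.sum_mul_normSq_mulVec_le hsymm (d := fun a => p a / q a)
    (fun a => div_pos (hp a) (hq a)) (e := fun b => r b / s b) (fun b => div_pos (hr b) (hs b))
    (W := Q * V * T)
    (by
      have hQQ : Q * 1 * Q = diagonal fun a => (q a : ℂ) := by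
        rw [Matrix.mul_one, hQ, diagonal_mul_diagonal]
        exact congrArg _ (funext fun a => hsq (hq a))
      have := hcomp 1
      rw [hQQ, hVq, Matrix.mul_one] at this
      rw [this, hT, diagonal_mul_diagonal, diagonal_mul_diagonal, ← diagonal_one]
      refine congrArg _ (funext fun b => ?_)
      rw [← hsq (hs b), Complex.ofReal_inv]
      have := hsq0 (hs b)
      field_simp)
    (by
      have hQQ : Q * (diagonal fun a => ((p a / q a : ℝ) : ℂ)) * Q =
          diagonal fun a => (p a : ℂ) := by
        rw [hQ, diagonal_mul_diagonal, diagonal_mul_diagonal]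
        refine congrArg _ (funext fun a => ?_)
        rw [Complex.ofReal_div, ← hsq (hq a)]
        have := hsq0 (hq a)
        field_simp
      rw [hcomp, hQQ, hVp, hT, diagonal_mul_diagonal, diagonal_mul_diagonal]
      refine congrArg _ (funext fun b => ?_)
      rw [Complex.ofReal_div, ← hsq (hs b), Complex.ofReal_inv]
      have := hsq0 (hs b)
      field_simp)
    (fun b => ((√(s b) : ℝ) : ℂ) * y b)
  have hTy : T *ᵥ (fun b => ((√(s b) : ℝ) : ℂ) * y b) = y := by
    ext b
    rw [hT, mulVec_diagonal, Complex.ofReal_inv, inv_mul_cancel_left₀ (hsq0 (hs b))]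
  rw [← mulVec_mulVec, hTy, ← mulVec_mulVec] at h
  refine le_of_eq_of_le (Finset.sum_congr rfl fun a _ => ?_)
    (h.trans_eq (Finset.sum_congr rfl fun b _ => ?_))
  · rw [hQ, mulVec_diagonal, Complex.normSq_mul, Complex.normSq_ofReal,
      Real.mul_self_sqrt (hq a).le]
    ring
  · rw [Complex.normSq_mul, Complex.normSq_ofReal, Real.mul_self_sqrt (hs b).le]
    ring

theorem re_conj_mul_le {g : ℝ} (hg : 0 < g) (z w : ℂ) :
    (star z * w).re ≤ (g * Complex.normSq z + Complex.normSq w / g) / 2 := by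
  have h : 0 ≤ Complex.normSq ((g : ℂ) * z - w) / g := div_nonneg (Complex.normSq_nonneg _) hg.le
  rw [Complex.normSq_sub, Complex.normSq_mul, Complex.normSq_ofReal, mul_assoc, mul_assoc,
    Complex.re_ofReal_mul] at h
  have h1 : (z * (starRingEnd ℂ) w).re = (star z * w).re := by
    simp [Complex.mul_re]
  rw [h1] at h
  have h2 : (g * (g * Complex.normSq z) + Complex.normSq w - 2 * (g * (star z * w).re)) / g =
      g * Complex.normSq z + Complex.normSq w / g - 2 * (star z * w).re := by
    field_simp
  rw [h2] at h
  linarith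

/-- Duality between contractive weighted estimates for `V` and for `Vᴴ`. -/
theorem sum_normSq_conjTranspose_mulVec_div_le {κ β : Type} [Fintype κ] [Fintype β]
    {g : κ → ℝ} (hg : ∀ a, 0 < g a) {h : β → ℝ} (hh : ∀ b, 0 < h b) {V : Matrix κ β ℂ}
    (hV : ∀ y : β → ℂ, ∑ a, g a * Complex.normSq ((V *ᵥ y) a) ≤ ∑ b, h b * Complex.normSq (y b))
    (X : κ → ℂ) :
    ∑ b, Complex.normSq ((Vᴴ *ᵥ X) b) / h b ≤ ∑ a, Complex.normSq (X a) / g a := by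
  set x := Vᴴ *ᵥ X with hx
  set N := ∑ b, Complex.normSq (x b) / h b with hN
  set y : β → ℂ := fun b => ((h b)⁻¹ : ℝ) * x b with hy
  have h1 : ∑ b, h b * Complex.normSq (y b) = N := by
    refine Finset.sum_congr rfl fun b _ => ?_
    have := (hh b).ne'
    rw [hy, Complex.normSq_mul, Complex.normSq_ofReal]
    field_simp
  have h2 : (star y ⬝ᵥ x).re = N := by
    rw [dotProduct, Complex.re_sum]
    refine Finset.sum_congr rfl fun b _ => ?_
    simp only [hy, Pi.star_apply, star_mul', RCLike.star_def, Complex.conj_ofReal, mul_assoc]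
    rw [← Complex.normSq_eq_conj_mul_self, ← Complex.ofReal_mul, Complex.ofReal_re]
    ring
  have h3 : star y ⬝ᵥ x = star (V *ᵥ y) ⬝ᵥ X := by
    rw [hx, dotProduct_mulVec, star_mulVec]
  have h4 : (star (V *ᵥ y) ⬝ᵥ X).re ≤
      ∑ a, (g a * Complex.normSq ((V *ᵥ y) a) + Complex.normSq (X a) / g a) / 2 := by
    rw [dotProduct, Complex.re_sum]
    exact Finset.sum_le_sum fun a _ => re_conj_mul_le (hg a) _ _
  rw [← Finset.sum_div, Finset.sum_add_distrib] at h4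
  have h5 := hV y
  rw [h1] at h5
  rw [h3] at h2
  linarith

/-- Monotonicity of the skew information under the dual of a multiplicative `⋆`-preserving map `Ψ`,
for diagonal density matrices. -/
theorem OperatorMonotone.sum_chat_le (hf : OperatorMonotone f) (hpos : ∀ t > 0, 0 < f t)
    (hsymm : ∀ t > 0, f t = t * f (1 / t)) {l : κ → ℝ} (hl : ∀ k, 0 < l k) {μ : β → ℝ}
    (hμ : ∀ i, 0 < μ i) {Ψ : Matrix β β ℂ → Matrix κ κ ℂ}
    (hmul : ∀ X Y, Ψ (X * Y) = Ψ X * Ψ Y) (hstar : ∀ X, Ψ Xᴴ = (Ψ X)ᴴ)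
    (htr : ∀ Y, (Ψ Y * diagonal fun k => (l k : ℂ)).trace =
      (Y * diagonal fun i => (μ i : ℂ)).trace) (Y : Matrix β β ℂ) :
    ∑ i, ∑ j, chat f (μ i) (μ j) * Complex.normSq (Y i j) ≤
      ∑ i, ∑ j, chat f (l i) (l j) * Complex.normSq (Ψ Y i j) := by
  set E : β × β → Matrix β β ℂ := fun b => single b.1 b.2 1 with hE
  set V : Matrix (κ × κ) (β × β) ℂ := of fun a b => Ψ (E b) a.1 a.2 with hV
  have hsum : ∀ (b : β × β) (Z : Matrix κ κ ℂ),
      ∑ a : κ × κ, star (Ψ (E b) a.1 a.2) * Z a.1 a.2 = (Ψ (E b)ᴴ * Z).trace := fun b Z => by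
    rw [hstar, Fintype.sum_prod_type, Finset.sum_comm]
    simp [Matrix.trace, Matrix.mul_apply]
  have htrE : ∀ (b : β × β) (Z : Matrix β β ℂ), ((E b)ᴴ * Z).trace = Z b.1 b.2 := fun b Z => by
    simp [hE, Matrix.trace_single_mul]
  have hEap : ∀ b b' : β × β, E b' b.1 b.2 = if b = b' then 1 else 0 := fun b b' => by
    simp only [hE, single_apply, Prod.ext_iff, eq_comm]
  have hVp : Vᴴ * (diagonal fun a : κ × κ => (l a.1 : ℂ)) * V =
      diagonal fun b : β × β => (μ b.1 : ℂ) := by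
    ext b b'
    have h1 : (Vᴴ * (diagonal fun a : κ × κ => (l a.1 : ℂ)) * V) b b' =
        (Ψ (E b)ᴴ * ((diagonal fun k => (l k : ℂ)) * Ψ (E b'))).trace := by
      rw [← hsum, Matrix.mul_apply]
      refine Finset.sum_congr rfl fun a _ => ?_
      simp only [hV, conjTranspose_apply, of_apply, Matrix.mul_diagonal, Matrix.diagonal_mul]
      ring
    rw [h1, ← Matrix.mul_assoc, Matrix.trace_mul_comm, ← Matrix.mul_assoc, ← hmul, htr,
      Matrix.trace_mul_comm, ← Matrix.mul_assoc, Matrix.trace_mul_comm, htrE, Matrix.diagonal_mul,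
      hEap, diagonal_apply, mul_ite, mul_one, mul_zero]
  have hVq : Vᴴ * (diagonal fun a : κ × κ => (l a.2 : ℂ)) * V =
      diagonal fun b : β × β => (μ b.2 : ℂ) := by
    ext b b'
    have h1 : (Vᴴ * (diagonal fun a : κ × κ => (l a.2 : ℂ)) * V) b b' =
        (Ψ (E b)ᴴ * (Ψ (E b') * diagonal fun k => (l k : ℂ))).trace := by
      rw [← hsum, Matrix.mul_apply]
      refine Finset.sum_congr rfl fun a _ => ?_
      simp only [hV, conjTranspose_apply, of_apply, Matrix.mul_diagonal]
      ring
    rw [h1, ← Matrix.mul_assoc, ← hmul, htr, Matrix.mul_assoc, htrE, Matrix.mul_diagonal, hEap,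
      diagonal_apply, ite_mul, one_mul, zero_mul]
  have hx : Vᴴ *ᵥ (fun a : κ × κ => ((l a.1 - l a.2 : ℝ) : ℂ) * Ψ Y a.1 a.2) =
      fun b : β × β => ((μ b.1 - μ b.2 : ℝ) : ℂ) * Y b.1 b.2 := by
    ext b
    have h1 : (Vᴴ *ᵥ (fun a : κ × κ => ((l a.1 - l a.2 : ℝ) : ℂ) * Ψ Y a.1 a.2)) b =
        (Ψ (E b)ᴴ * ((diagonal fun k => (l k : ℂ)) * Ψ Y -
          Ψ Y * diagonal fun k => (l k : ℂ))).trace := by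
      rw [← hsum, mulVec, dotProduct]
      refine Finset.sum_congr rfl fun a _ => ?_
      simp only [hV, conjTranspose_apply, of_apply, Matrix.sub_apply, Matrix.mul_diagonal,
        Matrix.diagonal_mul]
      push_cast
      ring
    rw [h1, Matrix.mul_sub, Matrix.trace_sub, ← Matrix.mul_assoc, Matrix.trace_mul_comm,
      ← Matrix.mul_assoc, ← Matrix.mul_assoc, ← hmul, ← hmul, htr, htr, Matrix.trace_mul_comm,
      ← Matrix.mul_assoc, Matrix.trace_mul_comm, Matrix.mul_assoc, htrE, htrE,
      Matrix.diagonal_mul, Matrix.mul_diagonal]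
    push_cast
    ring
  have hchat : ∀ (x y : ℝ) (z : ℂ), chat f x y * Complex.normSq z =
      Complex.normSq (((x - y : ℝ) : ℂ) * z) / (y * f (x / y)) := fun x y z => by
    rw [chat, Complex.normSq_mul, Complex.normSq_ofReal]
    ring
  have hpos' : ∀ x y : ℝ, 0 < x → 0 < y → 0 < y * f (x / y) := fun x y hx hy =>
    mul_pos hy (hpos _ (div_pos hx hy))
  have := sum_normSq_conjTranspose_mulVec_div_le (fun a : κ × κ => hpos' _ _ (hl a.1) (hl a.2))
    (fun b : β × β => hpos' _ _ (hμ b.1) (hμ b.2))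
    (fun y => hf.transformer hsymm (fun a : κ × κ => hl a.1) (fun a => hl a.2)
      (fun b : β × β => hμ b.1) (fun b => hμ b.2) hVp hVq y)
    (fun a : κ × κ => ((l a.1 - l a.2 : ℝ) : ℂ) * Ψ Y a.1 a.2)
  rw [hx, Fintype.sum_prod_type, Fintype.sum_prod_type] at this
  simpa only [hchat] using this

theorem skewSum_eq (f : ℝ → ℝ) {ρ : Matrix κ κ ℂ} (hρ : ρ.IsHermitian) (A : Matrix κ κ ℂ) :
    skewSum f ρ A = ∑ i, ∑ j, chat f (hρ.eigenvalues i) (hρ.eigenvalues j) *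
      Complex.normSq (((hρ.eigenvectorUnitary : Matrix κ κ ℂ)ᴴ * A *
        (hρ.eigenvectorUnitary : Matrix κ κ ℂ)) i j) := by
  rw [skewSum, dif_pos hρ]
  refine Finset.sum_congr rfl fun i _ => Finset.sum_congr rfl fun j _ => ?_
  rw [Matrix.mul_assoc, Matrix.mul_apply, dotProduct]
  rfl

/-- Monotonicity of the skew information: if `σ` is the restriction of the state `ρ` along the
multiplicative `⋆`-preserving map `Φ`, then the skew information of `A` in `σ` is at most that of
`Φ A` in `ρ`. -/
theorem OperatorMonotone.skewSum_le (hf : OperatorMonotone f) (hpos : ∀ t > 0, 0 < f t)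
    (hsymm : ∀ t > 0, f t = t * f (1 / t)) {ρ : Matrix κ κ ℂ} (hρ : ρ.PosDef)
    {σ : Matrix β β ℂ} (hσ : σ.PosDef) {Φ : Matrix β β ℂ → Matrix κ κ ℂ}
    (hmul : ∀ X Y, Φ (X * Y) = Φ X * Φ Y) (hstar : ∀ X, Φ Xᴴ = (Φ X)ᴴ)
    (htr : ∀ Y, (Φ Y * ρ).trace = (Y * σ).trace) (A : Matrix β β ℂ) :
    skewSum f σ A ≤ skewSum f ρ (Φ A) := by
  rw [skewSum_eq f hρ.1, skewSum_eq f hσ.1]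
  set U : Matrix κ κ ℂ := (hρ.1.eigenvectorUnitary : Matrix κ κ ℂ) with hU
  set S : Matrix β β ℂ := (hσ.1.eigenvectorUnitary : Matrix β β ℂ) with hS
  have hSS : Sᴴ * S = 1 := hσ.1.eigenvectorUnitary_conjTranspose_mul
  have hSS' : S * Sᴴ = 1 := hσ.1.eigenvectorUnitary_mul_conjTranspose
  have hUU' : U * Uᴴ = 1 := hρ.1.eigenvectorUnitary_mul_conjTranspose
  have h := hf.sum_chat_le hpos hsymm hρ.eigenvalues_pos hσ.eigenvalues_pos
    (Ψ := fun Y => Uᴴ * Φ (S * Y * Sᴴ) * U)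
    (fun X Y => by
      have : S * (X * Y) * Sᴴ = (S * X * Sᴴ) * (S * Y * Sᴴ) := by
        simp only [Matrix.mul_assoc]
        rw [← Matrix.mul_assoc Sᴴ S, hSS, Matrix.one_mul]
      rw [this, hmul]
      simp only [Matrix.mul_assoc]
      rw [← Matrix.mul_assoc U Uᴴ, hUU', Matrix.one_mul])
    (fun X => by
      have : S * Xᴴ * Sᴴ = (S * X * Sᴴ)ᴴ := by
        simp only [conjTranspose_mul, conjTranspose_conjTranspose, Matrix.mul_assoc]
      rw [this, hstar]
      simp only [conjTranspose_mul, conjTranspose_conjTranspose, Matrix.mul_assoc])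
    (fun Y => by
      rw [Matrix.mul_assoc, ← hρ.1.mul_eigenvectorUnitary, Matrix.trace_mul_comm, ← hU,
        Matrix.mul_assoc, ← Matrix.mul_assoc U, hUU', Matrix.one_mul, Matrix.trace_mul_comm, htr,
        Matrix.mul_assoc, Matrix.trace_mul_comm, ← Matrix.mul_assoc, Matrix.mul_assoc Sᴴ,
        hσ.1.mul_eigenvectorUnitary, ← hS, ← Matrix.mul_assoc, hSS, Matrix.one_mul,
        Matrix.trace_mul_comm])
    (Sᴴ * A * S)
  have hA : S * (Sᴴ * A * S) * Sᴴ = A := by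
    rw [← Matrix.mul_assoc, ← Matrix.mul_assoc, hSS', Matrix.one_mul, Matrix.mul_assoc, hSS',
      Matrix.mul_one]
  simpa only [hA] using h

theorem skewSum_add_add_skewSum_sub (f : ℝ → ℝ) {ρ : Matrix κ κ ℂ} (hρ : ρ.IsHermitian)
    (A B : Matrix κ κ ℂ) :
    skewSum f ρ (A + B) + skewSum f ρ (A - B) = 2 * (skewSum f ρ A + skewSum f ρ B) := by
  simp only [skewSum_eq f hρ, ← Finset.sum_add_distrib, Finset.mul_sum, Matrix.mul_add,
    Matrix.mul_sub, Matrix.add_mul, Matrix.sub_mul, Matrix.add_apply, Matrix.sub_apply]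
  refine Finset.sum_congr rfl fun i _ => Finset.sum_congr rfl fun j _ => ?_
  rw [Complex.normSq_add, Complex.normSq_sub]
  ring

end Monotonicity

section PartialTrace

variable {n m : ℕ} {ρ : Matrix (Fin n × Fin m) (Fin n × Fin m) ℂ}

theorem trace_kronecker_one_mul (Y : Matrix (Fin n) (Fin n) ℂ) :
    ((Y ⊗ₖ (1 : Matrix (Fin m) (Fin m) ℂ)) * ρ).trace = (Y * ptrace2 ρ).trace := by
  simp only [Matrix.trace, Matrix.diag_apply, Matrix.mul_apply, kroneckerMap_apply, one_apply,
    Fintype.sum_prod_type, ptrace2, of_apply, Finset.mul_sum]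
  refine Finset.sum_congr rfl fun i _ => ?_
  rw [Finset.sum_comm]
  simp

theorem trace_one_kronecker_mul (Y : Matrix (Fin m) (Fin m) ℂ) :
    (((1 : Matrix (Fin n) (Fin n) ℂ) ⊗ₖ Y) * ρ).trace = (Y * ptrace1 ρ).trace := by
  simp only [Matrix.trace, Matrix.diag_apply, Matrix.mul_apply, kroneckerMap_apply, one_apply,
    Fintype.sum_prod_type, ptrace1, of_apply, Finset.mul_sum]
  rw [Finset.sum_comm]
  refine Finset.sum_congr rfl fun j _ => ?_
  rw [Finset.sum_comm (s := Finset.univ (α := Fin m))]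
  simp

theorem Matrix.PosDef.ptrace2 [Nonempty (Fin m)] (hρ : ρ.PosDef) : (ptrace2 ρ).PosDef := by
  have h : _root_.ptrace2 ρ = ∑ j, ρ.submatrix (fun i => (i, j)) (fun i => (i, j)) := by
    ext i i'
    simp [_root_.ptrace2, Matrix.sum_apply]
  rw [h]
  exact posDef_sum Finset.univ_nonempty fun j _ => hρ.submatrix (Prod.mk_left_injective j)

theorem Matrix.PosDef.ptrace1 [Nonempty (Fin n)] (hρ : ρ.PosDef) : (ptrace1 ρ).PosDef := by
  have h : _root_.ptrace1 ρ = ∑ i, ρ.submatrix (fun j => (i, j)) (fun j => (i, j)) := by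
    ext j j'
    simp [_root_.ptrace1, Matrix.sum_apply]
  rw [h]
  exact posDef_sum Finset.univ_nonempty fun i _ => hρ.submatrix (Prod.mk_right_injective i)

end PartialTrace

/-- Weak superadditivity:
`I^c_ρ(A ⊗ 1₂ + 1₁ ⊗ B) + I^c_ρ(A ⊗ 1₂ − 1₁ ⊗ B) ≥ 2·(I^c_{ρ₁}(A) + I^c_{ρ₂}(B))`
for a regular `f ∈ F_op` with Morozova-Chentsov function `c`. -/
theorem Ic_weak_superadditive' {n m : ℕ} (f : ℝ → ℝ)
    (hf_mono : OperatorMonotone f) (hf_pos : ∀ t > 0, 0 < f t)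
    (hf_symm : ∀ t > 0, f t = t * f (1 / t)) (hf_one : f 1 = 1)
    (hf_reg : 0 < f 0)
    (hf_cont : Filter.Tendsto f (nhdsWithin 0 (Set.Ioi 0)) (nhds (f 0)))
    (ρ : Matrix (Fin n × Fin m) (Fin n × Fin m) ℂ) (hρ : ρ.PosDef) (hρtr : ρ.trace = 1)
    (A : Matrix (Fin n) (Fin n) ℂ) (hA : A.IsHermitian)
    (B : Matrix (Fin m) (Fin m) ℂ) (hB : B.IsHermitian) :
    2 * (Ic f (ptrace2 ρ) A + Ic f (ptrace1 ρ) B) ≤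
      Ic f ρ (A ⊗ₖ (1 : Matrix (Fin m) (Fin m) ℂ) + (1 : Matrix (Fin n) (Fin n) ℂ) ⊗ₖ B) +
      Ic f ρ (A ⊗ₖ (1 : Matrix (Fin m) (Fin m) ℂ) - (1 : Matrix (Fin n) (Fin n) ℂ) ⊗ₖ B) := by
  have hne : Nonempty (Fin n × Fin m) := by
    by_contra h
    rw [not_nonempty_iff] at h
    simp [Matrix.trace] at hρtr
  obtain ⟨i₀, j₀⟩ := hne
  have : Nonempty (Fin n) := ⟨i₀⟩
  have : Nonempty (Fin m) := ⟨j₀⟩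
  have h1 := hf_mono.skewSum_le hf_pos hf_symm hρ hρ.ptrace2
    (Φ := fun Y => Y ⊗ₖ (1 : Matrix (Fin m) (Fin m) ℂ))
    (fun X Y => by rw [← mul_kronecker_mul, Matrix.one_mul])
    (fun X => by rw [conjTranspose_kronecker, conjTranspose_one]) trace_kronecker_one_mul A
  have h2 := hf_mono.skewSum_le hf_pos hf_symm hρ hρ.ptrace1
    (Φ := fun Y => (1 : Matrix (Fin n) (Fin n) ℂ) ⊗ₖ Y)
    (fun X Y => by rw [← mul_kronecker_mul, Matrix.one_mul])
    (fun X => by rw [conjTranspose_kronecker, conjTranspose_one]) trace_one_kronecker_mul B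
  simp only [Ic]
  rw [← mul_add, ← mul_add, skewSum_add_add_skewSum_sub f hρ.1, mul_left_comm]
  exact mul_le_mul_of_nonneg_left (by linarith) (by positivity)
end

section
/- For 1 < p ≤ 2 let f_p(t) = p(1−p)·(t−1)² / ((t^p − 1)(t^{1−p} − 1)) for t > 0, t ≠ 1, and f_p(1) = 1. Then f_p is a non-regular function in F_op: f_p(t) > 0 for all t > 0, f_p is operator monotone on (0,∞), f_p(t) = t·f_p(1/t) for all t > 0, f_p(1) = 1, and f_p(t) → 0 as t → 0⁺. -/
open Matrix Kronecker ComplexOrder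

/-- The Wigner-Yanase-Dyson function
`f_p(t) = p(1−p)·(t−1)² / ((tᵖ − 1)(t^{1−p} − 1))` for `t ≠ 1`, and `f_p(1) = 1`. -/
noncomputable def fWYD (p : ℝ) (t : ℝ) : ℝ :=
  if t = 1 then 1 else p * (1 - p) * (t - 1) ^ 2 / ((t ^ p - 1) * (t ^ (1 - p) - 1))

section MatrixFunctionalCalculus

variable {ι : Type} [Fintype ι] [DecidableEq ι]

theorem matFun_eq_cfc (g : ℝ → ℝ) {M : Matrix ι ι ℂ} (hM : M.IsHermitian) :
    matFun g M = cfc g M := by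
  rw [hM.cfc_eq, matFun, dif_pos hM, Matrix.IsHermitian.cfc, Unitary.conjStarAlgAut_apply]
  ext i j
  simp [Matrix.sum_apply, Matrix.mul_apply, Matrix.vecMulVec_apply, Matrix.diagonal_apply,
    Matrix.star_apply]
  exact Finset.sum_congr rfl fun _ _ => by ring

theorem isHermitian_matFun (g : ℝ → ℝ) {M : Matrix ι ι ℂ} (hM : M.IsHermitian) :
    (matFun g M).IsHermitian := by
  rw [matFun_eq_cfc g hM]
  exact cfc_predicate g M

theorem continuousOn_spectrum (g : ℝ → ℝ) (M : Matrix ι ι ℂ) :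
    ContinuousOn g (spectrum ℝ M) := by
  rw [continuousOn_iff_continuous_domRestrict]
  fun_prop

theorem pos_of_mem_spectrum {M : Matrix ι ι ℂ} (hM : M.PosDef) {t : ℝ}
    (ht : t ∈ spectrum ℝ M) : 0 < t := by
  rw [hM.isHermitian.spectrum_real_eq_range_eigenvalues] at ht
  obtain ⟨i, rfl⟩ := ht
  exact hM.eigenvalues_pos i

theorem matFun_congr {g h : ℝ → ℝ} (hgh : ∀ t > 0, g t = h t) {M : Matrix ι ι ℂ}
    (hM : M.PosDef) : matFun g M = matFun h M := by
  rw [matFun_eq_cfc g hM.isHermitian, matFun_eq_cfc h hM.isHermitian]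
  exact cfc_congr fun t ht => hgh t (pos_of_mem_spectrum hM ht)

theorem matFun_neg (g : ℝ → ℝ) {M : Matrix ι ι ℂ} (hM : M.IsHermitian) :
    matFun (fun t => -g t) M = -matFun g M := by
  rw [matFun_eq_cfc _ hM, matFun_eq_cfc _ hM, cfc_neg]

theorem matFun_const_mul (c : ℝ) (g : ℝ → ℝ) {M : Matrix ι ι ℂ} (hM : M.IsHermitian) :
    matFun (fun t => c * g t) M = c • matFun g M := by
  rw [matFun_eq_cfc _ hM, matFun_eq_cfc _ hM, cfc_const_mul c g M (continuousOn_spectrum _ _)]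

theorem matFun_const_add (c : ℝ) (g : ℝ → ℝ) {M : Matrix ι ι ℂ} (hM : M.IsHermitian) :
    matFun (fun t => c + g t) M = algebraMap ℝ (Matrix ι ι ℂ) c + matFun g M := by
  rw [matFun_eq_cfc _ hM, matFun_eq_cfc _ hM,
    cfc_const_add c g M (continuousOn_spectrum _ _) hM.isSelfAdjoint]

theorem matFun_id {M : Matrix ι ι ℂ} (hM : M.IsHermitian) : matFun (fun t => t) M = M := by
  rw [matFun_eq_cfc _ hM, cfc_id' ℝ M hM.isSelfAdjoint]

theorem matFun_inv {g : ℝ → ℝ} (hg : ∀ t > 0, g t ≠ 0) {M : Matrix ι ι ℂ} (hM : M.PosDef) :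
    matFun (fun t => (g t)⁻¹) M = (matFun g M)⁻¹ := by
  have hH := hM.isHermitian
  rw [matFun_eq_cfc _ hH, matFun_eq_cfc _ hH,
    cfc_inv g M (fun t ht => hg t (pos_of_mem_spectrum hM ht)) (continuousOn_spectrum _ _) hH.isSelfAdjoint,
    Matrix.nonsing_inv_eq_ringInverse]

/-- The quadratic form of `matFun g M` at a vector is a nonnegative combination of the values of
`g` at the eigenvalues, with weights independent of `g`. -/
theorem exists_weights_dotProduct_matFun {M : Matrix ι ι ℂ} (hM : M.IsHermitian) (x : ι → ℂ) :
    ∃ c : ι → ℝ, (∀ i, 0 ≤ c i) ∧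
      ∀ g : ℝ → ℝ, star x ⬝ᵥ (matFun g M *ᵥ x) = ((∑ i, g (hM.eigenvalues i) * c i : ℝ) : ℂ) := by
  refine ⟨fun i => Complex.normSq (star ⇑(hM.eigenvectorBasis i) ⬝ᵥ x),
    fun i => Complex.normSq_nonneg _, fun g => ?_⟩
  rw [matFun, dif_pos hM, Matrix.sum_mulVec, dotProduct_sum, Complex.ofReal_sum]
  refine Finset.sum_congr rfl fun i _ => ?_
  have h : star x ⬝ᵥ ⇑(hM.eigenvectorBasis i) = star (star ⇑(hM.eigenvectorBasis i) ⬝ᵥ x) :=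
    Matrix.star_dotProduct _ _
  rw [Matrix.smul_mulVec, Matrix.vecMulVec_mulVec, dotProduct_smul, dotProduct_smul, h,
    Complex.ofReal_mul, Complex.normSq_eq_conj_mul_self]
  simp

theorem posDef_matFun {g : ℝ → ℝ} (hg : ∀ t > 0, 0 < g t) {M : Matrix ι ι ℂ} (hM : M.PosDef) :
    (matFun g M).PosDef := by
  have hH := hM.isHermitian
  have hne : ∀ t ∈ spectrum ℝ M, g t ≠ 0 :=
    fun t ht => (hg t (pos_of_mem_spectrum hM ht)).ne'
  have hpsd : (matFun g M).PosSemidef := by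
    refine .of_dotProduct_mulVec_nonneg (isHermitian_matFun g hH) fun x => ?_
    obtain ⟨c, hc, h⟩ := exists_weights_dotProduct_matFun hH x
    rw [h g, Complex.zero_le_real]
    exact Finset.sum_nonneg fun i _ => mul_nonneg (hg _ (hM.eigenvalues_pos i)).le (hc i)
  rw [hpsd.posDef_iff_isUnit, matFun_eq_cfc _ hH]
  exact (isUnit_cfc_iff g M (continuousOn_spectrum _ _) hH).2 hne

open scoped Matrix.Norms.L2Operator MatrixOrder in
theorem Matrix.PosDef.inv_sub_inv_posSemidef {P Q : Matrix ι ι ℂ} (hP : P.PosDef)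
    (hPQ : (Q - P).PosSemidef) : (P⁻¹ - Q⁻¹).PosSemidef := by
  rw [Matrix.nonsing_inv_eq_ringInverse, Matrix.nonsing_inv_eq_ringInverse]
  exact Matrix.le_iff.1 (CStarAlgebra.ringInverse_le_ringInverse (Matrix.le_iff.2 hPQ)
    (Matrix.isStrictlyPositive_iff_posDef.2 hP))

end MatrixFunctionalCalculus

namespace OperatorMonotone

theorem congr {g h : ℝ → ℝ} (hg : OperatorMonotone g) (hgh : ∀ t > 0, g t = h t) :
    OperatorMonotone h := fun k A B hA hB hAB => by
  rw [← matFun_congr hgh hA, ← matFun_congr hgh hB]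
  exact hg k A B hA hB hAB

theorem id : OperatorMonotone (fun t => t) := fun k A B hA hB hAB => by
  rwa [matFun_id hA.isHermitian, matFun_id hB.isHermitian]

theorem const_add {g : ℝ → ℝ} (hg : OperatorMonotone g) (c : ℝ) :
    OperatorMonotone (fun t => c + g t) := fun k A B hA hB hAB => by
  rw [matFun_const_add c g hA.isHermitian, matFun_const_add c g hB.isHermitian,
    add_sub_add_left_eq_sub]
  exact hg k A B hA hB hAB

theorem const_mul {g : ℝ → ℝ} (hg : OperatorMonotone g) {c : ℝ} (hc : 0 ≤ c) :
    OperatorMonotone (fun t => c * g t) := fun k A B hA hB hAB => by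
  rw [matFun_const_mul c g hA.isHermitian, matFun_const_mul c g hB.isHermitian, ← smul_sub]
  exact (hg k A B hA hB hAB).smul hc

theorem neg_inv {g : ℝ → ℝ} (hg : OperatorMonotone g) (hpos : ∀ t > 0, 0 < g t) :
    OperatorMonotone (fun t => -(g t)⁻¹) := fun k A B hA hB hAB => by
  have hne : ∀ t > 0, g t ≠ 0 := fun t ht => (hpos t ht).ne'
  rw [matFun_neg _ hA.isHermitian, matFun_neg _ hB.isHermitian, matFun_inv hne hA,
    matFun_inv hne hB, neg_sub_neg]
  exact (posDef_matFun hpos hA).inv_sub_inv_posSemidef (hg k A B hA hB hAB)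

theorem inv_of_neg {g : ℝ → ℝ} (hg : OperatorMonotone (fun t => -g t)) (hpos : ∀ t > 0, 0 < g t) :
    OperatorMonotone (fun t => (g t)⁻¹) := fun k A B hA hB hAB => by
  have hne : ∀ t > 0, g t ≠ 0 := fun t ht => (hpos t ht).ne'
  have h := hg k A B hA hB hAB
  rw [matFun_neg _ hA.isHermitian, matFun_neg _ hB.isHermitian, neg_sub_neg] at h
  rw [matFun_inv hne hA, matFun_inv hne hB]
  exact (posDef_matFun hpos hB).inv_sub_inv_posSemidef h

open MeasureTheory in
theorem integral {α : Type*} [MeasurableSpace α] {μ : Measure α} {k : α → ℝ → ℝ}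
    (hk : ∀ᵐ s ∂μ, OperatorMonotone (k s)) (hint : ∀ t > 0, Integrable (fun s => k s t) μ) :
    OperatorMonotone (fun t => ∫ s, k s t ∂μ) := fun n A B hA hB hAB => by
  have hHA := hA.isHermitian
  have hHB := hB.isHermitian
  refine .of_dotProduct_mulVec_nonneg
    ((isHermitian_matFun _ hHB).sub (isHermitian_matFun _ hHA)) fun x => ?_
  obtain ⟨a, -, ha⟩ := exists_weights_dotProduct_matFun hHA x
  obtain ⟨b, -, hb⟩ := exists_weights_dotProduct_matFun hHB x
  have key : ∀ g : ℝ → ℝ, 0 ≤ star x ⬝ᵥ ((matFun g B - matFun g A) *ᵥ x) ↔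
      ∑ i, g (hHA.eigenvalues i) * a i ≤ ∑ i, g (hHB.eigenvalues i) * b i := fun g => by
    rw [Matrix.sub_mulVec, dotProduct_sub, ha, hb, sub_nonneg, Complex.real_le_real]
  have hiA : ∀ i, Integrable (fun s => k s (hHA.eigenvalues i) * a i) μ :=
    fun i => (hint _ (hA.eigenvalues_pos i)).mul_const _
  have hiB : ∀ i, Integrable (fun s => k s (hHB.eigenvalues i) * b i) μ :=
    fun i => (hint _ (hB.eigenvalues_pos i)).mul_const _
  rw [key]
  simp only [← integral_mul_const]
  rw [← integral_finsetSum _ fun i _ => hiA i, ← integral_finsetSum _ fun i _ => hiB i]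
  refine integral_mono_ae (integrable_finsetSum _ fun i _ => hiA i)
    (integrable_finsetSum _ fun i _ => hiB i) ?_
  filter_upwards [hk] with s hs
  exact (key (k s)).1 ((hs n A B hA hB hAB).dotProduct_mulVec_nonneg x)

end OperatorMonotone

section StieltjesRepresentation

open MeasureTheory Set Real

theorem integral_Ioi_comp_inv (g : ℝ → ℝ) :
    ∫ x in Ioi (0 : ℝ), (x ^ 2)⁻¹ * g x⁻¹ = ∫ y in Ioi (0 : ℝ), g y := by
  rw [← integral_comp_rpow_Ioi g (show (-1 : ℝ) ≠ 0 by norm_num)]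
  refine setIntegral_congr_fun measurableSet_Ioi fun x hx => ?_
  have h : x ^ ((-1 : ℝ) - 1) = (x ^ 2)⁻¹ := by
    rw [show (-1 : ℝ) - 1 = -(2 : ℕ) by norm_num, rpow_neg (mem_Ioi.1 hx).le, rpow_natCast]
  simp only [h, rpow_neg_one, smul_eq_mul]
  norm_num

variable {q : ℝ}

theorem rpowIntegrand₀₁_one_sub {s : ℝ} (hs : 0 < s) {t : ℝ} (ht : 0 < t) :
    rpowIntegrand₀₁ (1 - q) s t = t * (s ^ (-q) / (s + t)) := by
  rw [rpowIntegrand₀₁, sub_eq_add_neg, rpow_add hs, rpow_one]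
  field_simp
  ring

theorem rpowIntegrand₀₁_eq_rpow_mul {s : ℝ} (hs : 0 < s) {t : ℝ} (ht : 0 < t) :
    rpowIntegrand₀₁ q s t = s ^ q * (t / (s * (s + t))) := by
  rw [rpowIntegrand₀₁]
  field_simp
  ring

theorem integral_rpowIntegrand₀₁_one_sub :
    ∫ s in Ioi 0, rpowIntegrand₀₁ (1 - q) s 1 = ∫ s in Ioi 0, rpowIntegrand₀₁ q s 1 := by
  rw [← integral_Ioi_comp_inv]
  refine setIntegral_congr_fun measurableSet_Ioi fun s hs => ?_
  have hs : 0 < s := hs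
  rw [rpowIntegrand₀₁_one_sub (inv_pos.2 hs) one_pos, rpowIntegrand₀₁_eq_rpow_mul hs one_pos,
    inv_rpow hs.le, rpow_neg hs.le]
  have := rpow_pos_of_pos hs q
  field_simp
  ring

theorem integral_rpow_neg_sub_rpow_div_sq :
    ∫ s in Ioi (0 : ℝ), (s ^ (-q) - s ^ q) / (1 + s) ^ 2 = 0 := by
  suffices h : ∫ s in Ioi (0 : ℝ), (s ^ (-q) - s ^ q) / (1 + s) ^ 2 =
      -∫ s in Ioi (0 : ℝ), (s ^ (-q) - s ^ q) / (1 + s) ^ 2 by linarith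
  conv_lhs => rw [← integral_Ioi_comp_inv]
  rw [← integral_neg]
  refine setIntegral_congr_fun measurableSet_Ioi fun s hs => ?_
  have hs : 0 < s := hs
  rw [inv_rpow hs.le, inv_rpow hs.le, rpow_neg hs.le]
  have := rpow_pos_of_pos hs q
  field_simp
  ring

theorem integrableOn_rpow_neg_sub_rpow_div_sq (hq : q ∈ Ioo 0 1) :
    IntegrableOn (fun s : ℝ => (s ^ (-q) - s ^ q) / (1 + s) ^ 2) (Ioi 0) := by
  have hq' : 1 - q ∈ Ioo 0 1 := ⟨by linarith [hq.2], by linarith [hq.1]⟩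
  refine ((integrableOn_rpowIntegrand₀₁_Ioi hq' zero_le_one).add
    (integrableOn_rpowIntegrand₀₁_Ioi hq zero_le_one)).mono' ?_ ?_
  · refine ContinuousOn.aestronglyMeasurable (fun s hs => ?_) measurableSet_Ioi
    have hs : 0 < s := hs
    refine ContinuousAt.continuousWithinAt ?_
    have h1 : (1 + s) ^ 2 ≠ 0 := by positivity
    have h2 : s ≠ 0 := hs.ne'
    fun_prop (disch := simp [*])
  · filter_upwards [ae_restrict_mem measurableSet_Ioi] with s hs
    have hs : 0 < s := hs
    have h1 := rpow_pos_of_pos hs q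
    have h2 := rpow_pos_of_pos hs (-q)
    simp only [Pi.add_apply]
    rw [rpowIntegrand₀₁_one_sub hs one_pos, rpowIntegrand₀₁_eq_rpow_mul hs one_pos, one_mul,
      Real.norm_eq_abs, sub_div, div_eq_mul_one_div (s ^ q)]
    refine (abs_sub _ _).trans ?_
    rw [abs_of_nonneg (by positivity), abs_of_nonneg (by positivity), add_comm 1 s]
    gcongr
    · nlinarith
    · nlinarith

/-- The density, up to a constant, of the Stieltjes measure of `1 / fWYD (1 + q)`. -/
noncomputable def stieltjesDensity (q s : ℝ) : ℝ := (s ^ (1 + q) + s ^ (-q)) / (1 + s) ^ 2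

theorem stieltjesDensity_pos {s : ℝ} (hs : 0 < s) : 0 < stieltjesDensity q s := by
  unfold stieltjesDensity
  positivity

theorem stieltjesDensity_decomposition {s t : ℝ} (hs : 0 < s) (ht : 0 < t) :
    (t - 1) ^ 2 * (stieltjesDensity q s * (s + t)⁻¹) =
      t⁻¹ * rpowIntegrand₀₁ (1 - q) s t - rpowIntegrand₀₁ (1 - q) s 1 +
        (t * rpowIntegrand₀₁ q s t - t * rpowIntegrand₀₁ q s 1) +
        (t - 1) * ((s ^ (-q) - s ^ q) / (1 + s) ^ 2) := by
  rw [stieltjesDensity, rpowIntegrand₀₁_one_sub hs ht, rpowIntegrand₀₁_one_sub hs one_pos,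
    rpowIntegrand₀₁_eq_rpow_mul hs ht, rpowIntegrand₀₁_eq_rpow_mul hs one_pos, rpow_add hs,
    rpow_one]
  generalize s ^ q = a
  generalize s ^ (-q) = b
  have : 1 + s ≠ 0 := by positivity
  have : s + 1 ≠ 0 := by positivity
  field_simp
  ring

theorem integrableOn_sq_mul_stieltjes (hq : q ∈ Ioo 0 1) {t : ℝ} (ht : 0 < t) :
    IntegrableOn (fun s => (t - 1) ^ 2 * (stieltjesDensity q s * (s + t)⁻¹)) (Ioi 0) ∧
      ∫ s in Ioi 0, (t - 1) ^ 2 * (stieltjesDensity q s * (s + t)⁻¹) =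
        (∫ s in Ioi 0, rpowIntegrand₀₁ q s 1) * (t ^ (1 + q) - t - 1 + t ^ (-q)) := by
  have hq' : 1 - q ∈ Ioo 0 1 := ⟨by linarith [hq.2], by linarith [hq.1]⟩
  have i1 := (integrableOn_rpowIntegrand₀₁_Ioi hq' ht.le).const_mul t⁻¹
  have i2 := integrableOn_rpowIntegrand₀₁_Ioi hq' zero_le_one
  have i3 := (integrableOn_rpowIntegrand₀₁_Ioi hq ht.le).const_mul t
  have i4 := (integrableOn_rpowIntegrand₀₁_Ioi hq zero_le_one).const_mul t
  have i5 := (integrableOn_rpow_neg_sub_rpow_div_sq hq).const_mul (t - 1)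
  have i12 : IntegrableOn (fun s => t⁻¹ * rpowIntegrand₀₁ (1 - q) s t -
      rpowIntegrand₀₁ (1 - q) s 1) (Ioi 0) := i1.sub i2
  have i34 : IntegrableOn (fun s => t * rpowIntegrand₀₁ q s t -
      t * rpowIntegrand₀₁ q s 1) (Ioi 0) := i3.sub i4
  have i1234 : IntegrableOn (fun s => t⁻¹ * rpowIntegrand₀₁ (1 - q) s t -
      rpowIntegrand₀₁ (1 - q) s 1 + (t * rpowIntegrand₀₁ q s t -
      t * rpowIntegrand₀₁ q s 1)) (Ioi 0) := i12.add i34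
  have heq : EqOn (fun s => (t - 1) ^ 2 * (stieltjesDensity q s * (s + t)⁻¹))
      (fun s => t⁻¹ * rpowIntegrand₀₁ (1 - q) s t - rpowIntegrand₀₁ (1 - q) s 1 +
        (t * rpowIntegrand₀₁ q s t - t * rpowIntegrand₀₁ q s 1) +
        (t - 1) * ((s ^ (-q) - s ^ q) / (1 + s) ^ 2)) (Ioi 0) :=
    fun s hs => stieltjesDensity_decomposition hs ht
  constructor
  · exact (integrableOn_congr_fun heq measurableSet_Ioi).2
      (i1234.add i5)
  · rw [setIntegral_congr_fun measurableSet_Ioi heq,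
      integral_add i1234 i5, integral_add i12 i34,
      integral_sub i1 i2, integral_sub i3 i4, integral_const_mul, integral_const_mul,
      integral_const_mul, integral_const_mul, integral_rpow_neg_sub_rpow_div_sq,
      integral_rpowIntegrand₀₁_eq_rpow_mul_const hq' ht.le,
      integral_rpowIntegrand₀₁_eq_rpow_mul_const hq ht.le, integral_rpowIntegrand₀₁_one_sub,
      rpow_add ht, sub_eq_add_neg (1 : ℝ) q, rpow_add ht, rpow_one]
    field_simp
    ring

theorem integrableOn_stieltjes (hq : q ∈ Ioo 0 1) {t : ℝ} (ht : 0 < t) :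
    IntegrableOn (fun s => stieltjesDensity q s * (s + t)⁻¹) (Ioi 0) := by
  have hne : ∀ t : ℝ, 0 < t → t ≠ 1 →
      IntegrableOn (fun s => stieltjesDensity q s * (s + t)⁻¹) (Ioi 0) := fun t ht h1 => by
    have h := (integrableOn_sq_mul_stieltjes hq ht).1.const_mul ((t - 1) ^ 2)⁻¹
    have h0 : (t - 1) ^ 2 ≠ 0 := pow_ne_zero 2 (sub_ne_zero.2 h1)
    simp only [inv_mul_cancel_left₀ h0] at h
    exact h
  rcases eq_or_ne t 1 with rfl | h1
  · refine ((hne 2 two_pos (by norm_num)).const_mul 2).mono' ?_ ?_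
    · unfold stieltjesDensity
      refine ContinuousOn.aestronglyMeasurable (fun s hs => ?_) measurableSet_Ioi
      have hs : 0 < s := hs
      refine ContinuousAt.continuousWithinAt ?_
      have h1 : (1 + s) ^ 2 ≠ 0 := by positivity
      have h2 : s ≠ 0 := hs.ne'
      have h3 : s + 1 ≠ 0 := by positivity
      fun_prop (disch := simp [*])
    · filter_upwards [ae_restrict_mem measurableSet_Ioi] with s hs
      have hs : 0 < s := hs
      have h := stieltjesDensity_pos (q := q) hs
      rw [Real.norm_of_nonneg (by positivity), mul_left_comm]
      refine mul_le_mul_of_nonneg_left ?_ h.le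
      rw [inv_le_iff_one_le_mul₀ (by positivity)]
      field_simp
      linarith
  · exact hne t ht h1

theorem antitoneOn_integral_stieltjes (hq : q ∈ Ioo 0 1) :
    AntitoneOn (fun t => ∫ s in Ioi 0, stieltjesDensity q s * (s + t)⁻¹) (Ioi 0) := by
  intro t ht u hu htu
  refine setIntegral_mono_on (integrableOn_stieltjes hq hu) (integrableOn_stieltjes hq ht)
    measurableSet_Ioi fun s hs => ?_
  have hs : 0 < s := hs
  have ht : 0 < t := ht
  have h := stieltjesDensity_pos (q := q) hs
  gcongr

end StieltjesRepresentation

section WignerYanaseDyson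

open MeasureTheory Set Real Filter Topology

theorem fWYD_one (p : ℝ) : fWYD p 1 = 1 := if_pos rfl

theorem fWYD_of_ne_one (p : ℝ) {t : ℝ} (h1 : t ≠ 1) :
    fWYD p t = p * (1 - p) * (t - 1) ^ 2 / ((t ^ p - 1) * (t ^ (1 - p) - 1)) := if_neg h1

theorem rpow_sub_one_mul_neg {p : ℝ} (hp : 1 < p) {t : ℝ} (ht : 0 < t) (h1 : t ≠ 1) :
    (t ^ p - 1) * (t ^ (1 - p) - 1) < 0 := by
  rcases lt_or_gt_of_ne h1 with h | h
  · exact mul_neg_of_neg_of_pos (sub_neg.2 (rpow_lt_one ht.le h (by linarith)))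
      (sub_pos.2 (one_lt_rpow_of_pos_of_lt_one_of_neg ht h (by linarith)))
  · exact mul_neg_of_pos_of_neg (sub_pos.2 (one_lt_rpow h (by linarith)))
      (sub_neg.2 (rpow_lt_one_of_one_lt_of_neg h (by linarith)))

theorem fWYD_pos {p : ℝ} (hp : 1 < p) {t : ℝ} (ht : 0 < t) : 0 < fWYD p t := by
  rcases eq_or_ne t 1 with rfl | h1
  · rw [fWYD_one]
    exact one_pos
  · rw [fWYD_of_ne_one p h1]
    have h : 0 < (t - 1) ^ 2 := by
      have := sub_ne_zero.2 h1
      positivity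
    exact div_pos_of_neg_of_neg
      (mul_neg_of_neg_of_pos (mul_neg_of_pos_of_neg (by linarith) (by linarith)) h)
      (rpow_sub_one_mul_neg hp ht h1)

theorem fWYD_symm (p : ℝ) {t : ℝ} (ht : 0 < t) : fWYD p t = t * fWYD p (1 / t) := by
  rcases eq_or_ne t 1 with rfl | h1
  · simp
  · have h1' : 1 / t ≠ 1 := fun h => h1 (by field_simp at h; exact h.symm)
    rw [fWYD_of_ne_one p h1, fWYD_of_ne_one p h1', one_div, inv_rpow ht.le, inv_rpow ht.le,
      rpow_sub ht, rpow_one]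
    have hp := rpow_pos_of_pos ht p
    have e1 : ((t ^ p)⁻¹ - 1) * ((t / t ^ p)⁻¹ - 1) =
        (t ^ p - 1) * (t / t ^ p - 1) * t⁻¹ := by
      field_simp
      ring
    have e2 : p * (1 - p) * (t⁻¹ - 1) ^ 2 = p * (1 - p) * (t - 1) ^ 2 * (t⁻¹ * t⁻¹) := by
      field_simp
      ring
    rw [e1, e2, ← mul_div_mul_right _ _ (inv_ne_zero ht.ne')]
    field_simp

theorem tendsto_fWYD_zero {p : ℝ} (hp : 1 < p) : Tendsto (fWYD p) (𝓝[>] 0) (𝓝 0) := by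
  have h0 : Tendsto (fun t : ℝ => t) (𝓝[>] 0) (𝓝 0) := nhdsWithin_le_nhds
  have h1 : Tendsto (fun t : ℝ => t ^ p) (𝓝[>] 0) (𝓝 0) := by
    have h := h0.rpow_const (p := p) (.inr (by linarith))
    rwa [zero_rpow (by linarith)] at h
  have h2 : Tendsto (fun t : ℝ => t ^ (1 - p)) (𝓝[>] 0) atTop :=
    tendsto_rpow_neg_nhdsGT_zero (by linarith)
  have h3 : Tendsto (fun t : ℝ => p * (1 - p) * (t - 1) ^ 2 / (t ^ p - 1)) (𝓝[>] 0)
      (𝓝 (p * (1 - p) * (0 - 1) ^ 2 / (0 - 1))) :=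
    (((h0.sub_const 1).pow 2).const_mul _).div (h1.sub_const 1) (by norm_num)
  have h4 := h3.mul (tendsto_atTop_add_const_right _ (-1) h2).inv_tendsto_atTop
  rw [mul_zero] at h4
  refine h4.congr' ?_
  filter_upwards [nhdsWithin_le_nhds (Iio_mem_nhds one_pos)] with t ht
  rw [fWYD_of_ne_one p (ne_of_lt ht), Pi.inv_apply, ← sub_eq_add_neg, ← div_eq_mul_inv, div_div]

theorem tendsto_rpow_sub_one_div (r : ℝ) :
    Tendsto (fun t : ℝ => (t ^ r - 1) / (t - 1)) (𝓝[≠] 1) (𝓝 r) := by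
  have h := (hasDerivAt_rpow_const (x := 1) (p := r) (.inl one_ne_zero)).tendsto_slope
  simpa only [slope_fun_def_field, one_rpow, mul_one] using h

theorem tendsto_fWYD_inv_one {p : ℝ} (hp : 1 < p) :
    Tendsto (fun t => (fWYD p t)⁻¹) (𝓝[≠] 1) (𝓝 1) := by
  have hp0 : p ≠ 0 := by linarith
  have hp1 : 1 - p ≠ 0 := by linarith
  have h := ((tendsto_rpow_sub_one_div p).mul (tendsto_rpow_sub_one_div (1 - p))).const_mul
    (p * (1 - p))⁻¹
  rw [inv_mul_cancel₀ (mul_ne_zero hp0 hp1)] at h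
  refine h.congr' ?_
  filter_upwards [self_mem_nhdsWithin] with t ht
  have ht' : t - 1 ≠ 0 := sub_ne_zero.2 ht
  rw [fWYD_of_ne_one p ht, inv_div]
  field_simp

theorem integral_stieltjes_eq_mul_fWYD_inv {q : ℝ} (hq : q ∈ Ioo 0 1) {t : ℝ} (ht : 0 < t) :
    ∫ s in Ioi 0, stieltjesDensity q s * (s + t)⁻¹ =
      (∫ s in Ioi 0, rpowIntegrand₀₁ q s 1) * ((1 + q) * q) * (fWYD (1 + q) t)⁻¹ := by
  set C := (∫ s in Ioi 0, rpowIntegrand₀₁ q s 1) * ((1 + q) * q)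
  have hp : 1 < 1 + q := by linarith [hq.1]
  have hq0 : q ≠ 0 := hq.1.ne'
  have hne : ∀ t : ℝ, 0 < t → t ≠ 1 → ∫ s in Ioi 0, stieltjesDensity q s * (s + t)⁻¹ =
      C * (fWYD (1 + q) t)⁻¹ := fun t ht h1 => by
    have h1' : t - 1 ≠ 0 := sub_ne_zero.2 h1
    have h := (integrableOn_sq_mul_stieltjes hq ht).2
    rw [integral_const_mul] at h
    rw [← mul_right_inj' (pow_ne_zero 2 h1'), h, fWYD_of_ne_one _ h1, inv_div,
      show 1 - (1 + q) = -q by ring]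
    have e : t ^ (1 + q) - t - 1 + t ^ (-q) = -((t ^ (1 + q) - 1) * (t ^ (-q) - 1)) := by
      have h2 : t ^ (1 + q) * t ^ (-q) = t := by
        rw [← rpow_add ht, add_neg_cancel_right, rpow_one]
      linear_combination h2
    rw [e]
    simp only [C]
    have : 1 + q ≠ 0 := by linarith
    field_simp
  rcases eq_or_ne t 1 with rfl | h1
  · rw [fWYD_one, inv_one]
    have hlim := (tendsto_fWYD_inv_one hp).const_mul C
    have hanti := antitoneOn_integral_stieltjes hq
    have hpos : ∀ᶠ t : ℝ in 𝓝 1, 0 < t := lt_mem_nhds one_pos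
    refine le_antisymm
      (ge_of_tendsto (hlim.mono_left (nhdsWithin_mono (s := Iio 1) 1 fun t ht => ne_of_lt ht)) ?_)
      (le_of_tendsto (hlim.mono_left (nhdsWithin_mono (s := Ioi 1) 1 fun t ht => ne_of_gt ht)) ?_)
    · filter_upwards [nhdsWithin_le_nhds hpos, self_mem_nhdsWithin] with t ht ht1
      rw [← hne t ht (ne_of_lt ht1)]
      exact hanti ht (mem_Ioi.2 one_pos) (le_of_lt ht1)
    · filter_upwards [nhdsWithin_le_nhds hpos, self_mem_nhdsWithin] with t ht ht1
      rw [← hne t ht (ne_of_gt ht1)]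
      exact hanti (mem_Ioi.2 one_pos) ht (le_of_lt ht1)
  · exact hne t ht h1

theorem fWYD_two_inv {t : ℝ} (ht : 0 < t) : (fWYD 2 t)⁻¹ = 1 / 2 + 1 / 2 * t⁻¹ := by
  rcases eq_or_ne t 1 with rfl | h1
  · rw [fWYD_one]
    norm_num
  · have h1' : t - 1 ≠ 0 := sub_ne_zero.2 h1
    rw [fWYD_of_ne_one _ h1, inv_div, show (1 : ℝ) - 2 = -1 by norm_num, rpow_neg_one, rpow_two]
    field_simp
    ring

theorem operatorMonotone_neg_fWYD_inv {p : ℝ} (hp1 : 1 < p) (hp2 : p ≤ 2) :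
    OperatorMonotone (fun t => -(fWYD p t)⁻¹) := by
  rcases hp2.eq_or_lt with rfl | hp2
  · refine (((OperatorMonotone.id.neg_inv fun t ht => ht).const_mul
      (c := 1 / 2) (by norm_num)).const_add (-(1 / 2))).congr fun t ht => ?_
    rw [fWYD_two_inv ht]
    ring
  · obtain ⟨q, rfl⟩ : ∃ q, p = 1 + q := ⟨p - 1, by ring⟩
    have hq : q ∈ Ioo 0 1 := ⟨by linarith, by linarith⟩
    have hC : 0 < (∫ s in Ioi 0, rpowIntegrand₀₁ q s 1) * ((1 + q) * q) :=
      mul_pos (integral_rpowIntegrand₀₁_one_pos hq) (mul_pos (by linarith) hq.1)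
    refine ((OperatorMonotone.integral (μ := volume.restrict (Ioi 0))
      (k := fun s t => stieltjesDensity q s * -(s + t)⁻¹) ?_ fun t ht => ?_).const_mul
        (inv_nonneg.2 hC.le)).congr fun t ht => ?_
    · filter_upwards [ae_restrict_mem measurableSet_Ioi] with s hs
      exact ((OperatorMonotone.id.const_add s).neg_inv fun t ht => add_pos hs ht).const_mul
        (stieltjesDensity_pos hs).le
    · simp only [mul_neg]
      exact (integrableOn_stieltjes hq ht).neg
    · simp only [mul_neg, integral_neg]
      rw [integral_stieltjes_eq_mul_fWYD_inv hq ht, inv_mul_cancel_left₀ hC.ne']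

theorem operatorMonotone_fWYD {p : ℝ} (hp1 : 1 < p) (hp2 : p ≤ 2) :
    OperatorMonotone (fWYD p) :=
  ((operatorMonotone_neg_fWYD_inv hp1 hp2).inv_of_neg fun _ ht =>
    inv_pos.2 (fWYD_pos hp1 ht)).congr fun _ _ => inv_inv _

end WignerYanaseDyson

/-- For `1 < p ≤ 2` the function `f_p` is a non-regular function in `F_op`: it is positive
on `(0,∞)`, operator monotone, satisfies `f_p(t) = t·f_p(1/t)` and `f_p(1) = 1`, and
`f_p(t) → 0` as `t → 0⁺`. -/
theorem fWYD_nonregular_Fop (p : ℝ) (hp1 : 1 < p) (hp2 : p ≤ 2) :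
    (∀ t > 0, 0 < fWYD p t) ∧
    OperatorMonotone (fWYD p) ∧
    (∀ t > 0, fWYD p t = t * fWYD p (1 / t)) ∧
    fWYD p 1 = 1 ∧
    Filter.Tendsto (fWYD p) (nhdsWithin 0 (Set.Ioi 0)) (nhds 0) := by
  exact ⟨fun t ht => fWYD_pos hp1 ht, operatorMonotone_fWYD hp1 hp2, fun t ht => fWYD_symm p ht,
    fWYD_one p, tendsto_fWYD_zero hp1⟩
end
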